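/- arXiv:math/0202172 — 3 statements merged into one kernel-verified Lean document; each statement's English description precedes it below -/
import Mathlib

section
/- Let X be a locally finite, connected, infinite graph whose vertex set admits a partition into finite nonempty sets A_1, A_2, A_3, … such that every vertex in A_n is adjacent only to vertices in A_{n−1} ∪ A_n ∪ A_{n+1}, and suppose the number a_n of edges between A_n and A_{n+1} is bounded. Then the simple random walk on X is recurrent. -/
open SimpleGraph Set

variable {V : Type*}

/-- n-step transition probabilities of the simple random walk on a locally finite graph. -/
noncomputable def pstep (X : SimpleGraph V) [X.LocallyFinite] [DecidableEq V] :
    ℕ → V → V → ℝ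
  | 0, x, y => if x = y then 1 else 0
  | (n + 1), x, y => ∑ z ∈ X.neighborFinset x, pstep X n z y / (X.degree x : ℝ)

/-- The simple random walk is recurrent iff the Green function diverges at 1,
i.e. the return probability series is not summable. -/
def RWRecurrent (X : SimpleGraph V) [X.LocallyFinite] [DecidableEq V] : Prop :=
  ∀ x : V, ¬ Summable (fun n => pstep X n x x)

lemma pstep_nonneg_aux (X : SimpleGraph V) [X.LocallyFinite] [DecidableEq V] (o : V) :
    ∀ n x, 0 ≤ pstep X n x o := by
  intro n
  induction n with
  | zero => intro x; simp only [pstep]; split_ifs <;> norm_num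
  | succ n ih =>
    intro x
    simp only [pstep]
    exact Finset.sum_nonneg fun z _ => div_nonneg (ih z) (Nat.cast_nonneg _)

lemma pstep_tendsto_aux (X : SimpleGraph V) [X.LocallyFinite] [DecidableEq V]
    (hconn : X.Connected) (o : V) (hs : Summable (fun n => pstep X n o o)) (x : V) :
    Filter.Tendsto (fun n => pstep X n x o) Filter.atTop (nhds 0) := by
  have step : ∀ x z, X.Adj x z →
      Filter.Tendsto (fun n => pstep X n x o) Filter.atTop (nhds 0) →
      Filter.Tendsto (fun n => pstep X n z o) Filter.atTop (nhds 0) := by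
    intro x z hxz h
    have h1 : Filter.Tendsto (fun n => (X.degree x : ℝ) * pstep X (n + 1) x o)
        Filter.atTop (nhds 0) := by
      simpa using ((Filter.tendsto_add_atTop_iff_nat 1).2 h).const_mul (X.degree x : ℝ)
    refine squeeze_zero (fun n => pstep_nonneg_aux X o n z) (fun n => ?_) h1
    have hd : 0 < (X.degree x : ℝ) := by
      exact_mod_cast (X.degree_pos_iff_exists_adj x).2 ⟨z, hxz⟩
    have : pstep X n z o / (X.degree x : ℝ) ≤ pstep X (n + 1) x o := by
      simp only [pstep]
      exact Finset.single_le_sum (f := fun z => pstep X n z o / (X.degree x : ℝ))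
        (fun w _ => div_nonneg (pstep_nonneg_aux X o n w) hd.le) (by simpa using hxz)
    rw [div_le_iff₀ hd] at this
    linarith
  obtain ⟨w⟩ := hconn.preconnected o x
  have key : ∀ u v : V, X.Walk u v →
      Filter.Tendsto (fun n => pstep X n u o) Filter.atTop (nhds 0) →
      Filter.Tendsto (fun n => pstep X n v o) Filter.atTop (nhds 0) := by
    intro u v w
    induction w with
    | nil => exact id
    | cons h _ ih => exact fun h' => ih (step _ _ h h')
  exact key o x w hs.tendsto_atTop_zero

/-- Summation by parts on a finite set. -/
lemma parts_aux (X : SimpleGraph V) [X.LocallyFinite] [DecidableEq V] [DecidableRel X.Adj]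
    (S : Finset V) (f h : V → ℝ)
    (hf : ∀ x ∈ S, f x ≠ 0 → ∀ y, X.Adj x y → y ∈ S) :
    ∑ x ∈ S, ∑ y ∈ S, (if X.Adj x y then (f x - f y) * (h x - h y) else 0) =
      2 * ∑ x ∈ S, f x * ∑ y ∈ X.neighborFinset x, (h x - h y) := by
  have h1 : ∑ x ∈ S, f x * ∑ y ∈ X.neighborFinset x, (h x - h y) =
      ∑ x ∈ S, ∑ y ∈ S, (if X.Adj x y then f x * (h x - h y) else 0) := by
    refine Finset.sum_congr rfl fun x hx => ?_
    by_cases h0 : f x = 0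
    · simp [h0]
    · rw [← Finset.sum_filter, Finset.mul_sum]
      refine Finset.sum_congr ?_ fun _ _ => rfl
      ext y
      simp only [mem_neighborFinset, Finset.mem_filter]
      exact ⟨fun h => ⟨hf x hx h0 y h, h⟩, fun h => h.2⟩
  have h2 : ∑ x ∈ S, f x * ∑ y ∈ X.neighborFinset x, (h x - h y) =
      ∑ x ∈ S, ∑ y ∈ S, (if X.Adj x y then - f y * (h x - h y) else 0) := by
    rw [h1, Finset.sum_comm]
    refine Finset.sum_congr rfl fun x _ => Finset.sum_congr rfl fun y _ => ?_
    simp only [X.adj_comm y x]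
    split_ifs
    · ring
    · rfl
  rw [two_mul]
  nth_rewrite 1 [h1]
  rw [h2, ← Finset.sum_add_distrib]
  refine Finset.sum_congr rfl fun x _ => ?_
  rw [← Finset.sum_add_distrib]
  refine Finset.sum_congr rfl fun y _ => ?_
  split_ifs
  · ring
  · simp

/-- Laplacian of the truncated Green function. -/
lemma green_lap_aux (X : SimpleGraph V) [X.LocallyFinite] [DecidableEq V] (o : V)
    (hdeg : ∀ x, 0 < X.degree x) (N : ℕ) (x : V) :
    ∑ y ∈ X.neighborFinset x,
      ((∑ n ∈ Finset.range N, pstep X n x o) - ∑ n ∈ Finset.range N, pstep X n y o) =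
    (X.degree x : ℝ) * ((if x = o then 1 else 0) - pstep X N x o) := by
  have hd : (X.degree x : ℝ) ≠ 0 := by exact_mod_cast (hdeg x).ne'
  have hstep : ∀ n, ∑ y ∈ X.neighborFinset x, pstep X n y o =
      (X.degree x : ℝ) * pstep X (n + 1) x o := by
    intro n
    simp only [pstep]
    rw [← Finset.sum_div]
    field_simp
  rw [Finset.sum_sub_distrib,
    Finset.sum_comm (s := X.neighborFinset x) (f := fun y n => pstep X n y o)]
  simp only [hstep, Finset.sum_const, card_neighborFinset_eq_degree, nsmul_eq_mul]
  rw [← Finset.mul_sum, ← mul_sub]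
  congr 1
  rw [← Finset.sum_sub_distrib, Finset.sum_range_sub']
  simp [pstep]

/-- Nash–Williams' criterion: if the vertex set of a locally finite, connected, infinite
graph is partitioned into finite nonempty shells with edges only between consecutive
shells, and the number of edges between consecutive shells is bounded, then the simple
random walk is recurrent. -/
theorem nashWilliams_recurrent (X : SimpleGraph V) [X.LocallyFinite] [DecidableEq V]
    (hconn : X.Connected) (hinf : Infinite V)
    (A : ℕ → Set V)
    (hcover : (⋃ n, A n) = Set.univ)
    (hdisj : Pairwise (Function.onFun Disjoint A))
    (hfin : ∀ n, (A n).Finite)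
    (hne : ∀ n, (A n).Nonempty)
    (hadj : ∀ n, ∀ x ∈ A n, ∀ y, X.Adj x y → y ∈ A (n - 1) ∪ A n ∪ A (n + 1))
    (M : ℕ)
    (hbound : ∀ n, {e : V × V | e.1 ∈ A n ∧ e.2 ∈ A (n + 1) ∧ X.Adj e.1 e.2}.ncard ≤ M) :
    RWRecurrent X := by
  classical
  intro o hs
  -- level function
  have hex : ∀ x, ∃ n, x ∈ A n := fun x => by
    have : x ∈ ⋃ n, A n := hcover ▸ Set.mem_univ x
    simpa using this
  choose l hl using hex
  have hlu : ∀ x n, x ∈ A n → l x = n := by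
    intro x n hx
    by_contra hne'
    exact Set.disjoint_left.1 (hdisj hne') (hl x) hx
  have hladj : ∀ x y, X.Adj x y → l y ≤ l x + 1 := by
    intro x y hxy
    rcases hadj _ x (hl x) y hxy with (h | h) | h <;> have := hlu _ _ h <;> omega
  have hSfin : ∀ L, {x | l x ≤ L}.Finite := by
    intro L
    refine ((Set.finite_Iic L).biUnion fun n _ => hfin n).subset ?_
    intro x hx
    simp only [Set.mem_iUnion]
    exact ⟨l x, hx, hl x⟩
  have hnt : Nontrivial V := inferInstance
  have hdeg : ∀ x, 0 < X.degree x := fun x => hconn.preconnected.degree_pos_of_nontrivial x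
  have hp0 := pstep_nonneg_aux X o
  have hplev : ∀ n x, pstep X n x o ≠ 0 → l x ≤ l o + n := by
    intro n
    induction n with
    | zero =>
      intro x hx
      simp only [pstep] at hx
      split_ifs at hx with h
      · simp [h]
      · simp at hx
    | succ n ih =>
      intro x hx
      simp only [pstep] at hx
      obtain ⟨z, hz, hz0⟩ := Finset.exists_ne_zero_of_sum_ne_zero hx
      have h1 := ih z (fun h => hz0 (by simp [h]))
      have h2 := hladj z x ((by simpa using hz : X.Adj x z).symm)
      omega
  set G : ℝ := ∑' n, pstep X n o o with hG
  have hG0 : 0 ≤ G := tsum_nonneg fun n => hp0 n o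
  have main : ∀ K : ℕ, ((X.degree o : ℝ) * ((K - l o : ℕ) : ℝ)) ^ 2 ≤
      ((M : ℝ) * K) * ((X.degree o : ℝ) * G) := by
    intro K
    set f : V → ℝ := fun x => ((K - l x : ℕ) : ℝ) with hf
    have hfsupp : ∀ x, f x ≠ 0 → l x < K := by
      intro x hx
      simp only [hf, ne_eq, Nat.cast_eq_zero] at hx
      omega
    set T : Finset V := (hSfin K).toFinset with hT
    have hlim : Filter.Tendsto (fun N => ((X.degree o : ℝ) * f o -
        ∑ x ∈ T, f x * ((X.degree x : ℝ) * pstep X N x o)) ^ 2) Filter.atTop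
        (nhds (((X.degree o : ℝ) * f o) ^ 2)) := by
      have h1 : Filter.Tendsto (fun N => ∑ x ∈ T, f x * ((X.degree x : ℝ) * pstep X N x o))
          Filter.atTop (nhds (∑ x ∈ T, f x * ((X.degree x : ℝ) * 0))) :=
        tendsto_finsetSum _ fun x _ =>
          ((pstep_tendsto_aux X hconn o hs x).const_mul _).const_mul _
      have h2 := (h1.const_sub ((X.degree o : ℝ) * f o)).pow 2
      simpa using h2
    refine le_of_tendsto hlim (Filter.Eventually.of_forall fun N => ?_)
    set g : V → ℝ := fun x => ∑ n ∈ Finset.range N, pstep X n x o with hg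
    have hg0 : ∀ x, 0 ≤ g x := fun x => Finset.sum_nonneg fun n _ => hp0 n x
    have hgsupp : ∀ x, g x ≠ 0 → l x ≤ l o + N := by
      intro x hx
      obtain ⟨n, hn, hn0⟩ := Finset.exists_ne_zero_of_sum_ne_zero hx
      have := hplev n x hn0
      have := Finset.mem_range.1 hn
      omega
    set S : Finset V := (hSfin (K + l o + N + 1)).toFinset with hS
    have hmS : ∀ x, x ∈ S ↔ l x ≤ K + l o + N + 1 := fun x => by simp [hS]
    have hoS : o ∈ S := by rw [hmS]; omega
    have hlap := green_lap_aux X o hdeg N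
    have e1 := parts_aux X S f g (by
      intro x _ h y hxy
      have := hfsupp x h
      have := hladj x y hxy
      rw [hmS]; omega)
    have e2 := parts_aux X S g g (by
      intro x _ h y hxy
      have := hgsupp x h
      have := hladj x y hxy
      rw [hmS]; omega)
    have hsplit : ∀ u : V → ℝ, ∑ x ∈ S, u x * ∑ y ∈ X.neighborFinset x, (g x - g y) =
        (X.degree o : ℝ) * u o - ∑ x ∈ S, u x * ((X.degree x : ℝ) * pstep X N x o) := by
      intro u
      have : ∀ x, u x * ∑ y ∈ X.neighborFinset x, (g x - g y) =
          (if x = o then (X.degree o : ℝ) * u o else 0) -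
            u x * ((X.degree x : ℝ) * pstep X N x o) := by
        intro x
        rw [hlap x]
        split_ifs with h
        · subst h; ring
        · ring
      simp only [this]
      rw [Finset.sum_sub_distrib, Finset.sum_ite_eq' S o]
      simp [hoS]
    have hTS : ∑ x ∈ S, f x * ((X.degree x : ℝ) * pstep X N x o) =
        ∑ x ∈ T, f x * ((X.degree x : ℝ) * pstep X N x o) := by
      symm
      apply Finset.sum_subset
      · intro x hx
        have : l x ≤ K := by simpa [hT] using hx
        rw [hmS]; omega
      · intro x _ hx
        have hx' : ¬ l x ≤ K := by simpa [hT] using hx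
        have : f x = 0 := by
          by_contra h
          have := hfsupp x h
          omega
        simp [this]
    rw [hsplit f, hTS] at e1
    rw [hsplit g] at e2
    have hgE : ∑ x ∈ S, ∑ y ∈ S, (if X.Adj x y then (g x - g y) * (g x - g y) else 0) ≤
        2 * ((X.degree o : ℝ) * G) := by
      rw [e2]
      have h1 : 0 ≤ ∑ x ∈ S, g x * ((X.degree x : ℝ) * pstep X N x o) :=
        Finset.sum_nonneg fun x _ =>
          mul_nonneg (hg0 x) (mul_nonneg (Nat.cast_nonneg _) (hp0 N x))
      have h2 : g o ≤ G := hs.sum_le_tsum _ fun n _ => hp0 n o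
      have h3 : (X.degree o : ℝ) * g o ≤ (X.degree o : ℝ) * G :=
        mul_le_mul_of_nonneg_left h2 (Nat.cast_nonneg _)
      linarith
    have hEfin : ∀ n, {e : V × V | e.1 ∈ A n ∧ e.2 ∈ A (n + 1) ∧ X.Adj e.1 e.2}.Finite :=
      fun n => ((hfin n).prod (hfin (n + 1))).subset fun e he => ⟨he.1, he.2.1⟩
    set I : ℕ → V → V → ℝ := fun n x y =>
      if x ∈ A n ∧ y ∈ A (n + 1) ∧ X.Adj x y then 1 else 0 with hI
    have hI0 : ∀ n x y, 0 ≤ I n x y := by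
      intro n x y; simp only [hI]; split_ifs <;> norm_num
    have hIsum : ∀ n, ∑ x ∈ S, ∑ y ∈ S, I n x y ≤ M := by
      intro n
      rw [← Finset.sum_product' S S (I n)]
      simp only [hI]
      rw [Finset.sum_boole]
      norm_cast
      refine le_trans ?_ (hbound n)
      rw [Set.ncard_eq_toFinset_card _ (hEfin n)]
      apply Finset.card_le_card
      intro e he
      simpa using (Finset.mem_filter.1 he).2
    have hfE : ∑ x ∈ S, ∑ y ∈ S, (if X.Adj x y then (f x - f y) * (f x - f y) else 0) ≤
        2 * ((M : ℝ) * K) := by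
      have hpt : ∀ x y, (if X.Adj x y then (f x - f y) * (f x - f y) else 0) ≤
          ∑ n ∈ Finset.range K, (I n x y + I n y x) := by
        intro x y
        have hnn : 0 ≤ ∑ n ∈ Finset.range K, (I n x y + I n y x) :=
          Finset.sum_nonneg fun n _ => add_nonneg (hI0 _ _ _) (hI0 _ _ _)
        split_ifs with hxy
        · have up : ∀ x y, X.Adj x y → l y = l x + 1 → l x < K →
              (f x - f y) * (f x - f y) = 1 ∧ I (l x) x y = 1 := by
            intro x y hxy h hK
            constructor
            · have : f x = f y + 1 := by
                simp only [hf]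
                have : K - l x = (K - l y) + 1 := by omega
                rw [this]; push_cast; ring
              rw [this]; ring
            · simp only [hI]
              rw [if_pos ⟨hl x, h ▸ hl y, hxy⟩]
          by_cases hfe : f x = f y
          · simpa [hfe] using hnn
          · have hne' : K - l x ≠ K - l y := fun h => hfe (by simp only [hf, h])
            have a1 := hladj x y hxy
            have a2 := hladj y x hxy.symm
            rcases (by omega : (l y = l x + 1 ∧ l x < K) ∨ (l x = l y + 1 ∧ l y < K)) with
              ⟨h, hK⟩ | ⟨h, hK⟩
            · obtain ⟨b1, b2⟩ := up x y hxy h hK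
              rw [b1]
              have := Finset.single_le_sum (f := fun n => I n x y + I n y x)
                (fun n _ => add_nonneg (hI0 n x y) (hI0 n y x)) (Finset.mem_range.2 hK)
              have := hI0 (l x) y x
              linarith
            · obtain ⟨b1, b2⟩ := up y x hxy.symm h hK
              have b1' : (f x - f y) * (f x - f y) = 1 := by rw [← b1]; ring
              rw [b1']
              have := Finset.single_le_sum (f := fun n => I n x y + I n y x)
                (fun n _ => add_nonneg (hI0 n x y) (hI0 n y x)) (Finset.mem_range.2 hK)
              have := hI0 (l y) x y
              linarith
        · exact hnn
      calc _ ≤ ∑ x ∈ S, ∑ y ∈ S, ∑ n ∈ Finset.range K, (I n x y + I n y x) :=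
            Finset.sum_le_sum fun x _ => Finset.sum_le_sum fun y _ => hpt x y
        _ = ∑ n ∈ Finset.range K, (∑ x ∈ S, ∑ y ∈ S, I n x y + ∑ x ∈ S, ∑ y ∈ S, I n x y) := by
            have : ∀ x ∈ S, ∑ y ∈ S, ∑ n ∈ Finset.range K, (I n x y + I n y x) =
              ∑ n ∈ Finset.range K, ∑ y ∈ S, (I n x y + I n y x) :=
              fun x _ => Finset.sum_comm
            rw [Finset.sum_congr rfl this, Finset.sum_comm]
            refine Finset.sum_congr rfl fun n _ => ?_
            simp only [Finset.sum_add_distrib]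
            congr 1
            exact Finset.sum_comm
        _ ≤ ∑ n ∈ Finset.range K, ((M : ℝ) + M) :=
            Finset.sum_le_sum fun n _ => add_le_add (hIsum n) (hIsum n)
        _ = 2 * ((M : ℝ) * K) := by simp; ring
    have hCS : (∑ x ∈ S, ∑ y ∈ S, (if X.Adj x y then (f x - f y) * (g x - g y) else 0)) ^ 2 ≤
        (∑ x ∈ S, ∑ y ∈ S, (if X.Adj x y then (f x - f y) * (f x - f y) else 0)) *
        (∑ x ∈ S, ∑ y ∈ S, (if X.Adj x y then (g x - g y) * (g x - g y) else 0)) := by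
      have := Finset.sum_mul_sq_le_sq_mul_sq (S ×ˢ S)
        (fun e => if X.Adj e.1 e.2 then f e.1 - f e.2 else 0)
        (fun e => if X.Adj e.1 e.2 then g e.1 - g e.2 else 0)
      rw [Finset.sum_product, Finset.sum_product, Finset.sum_product] at this
      have hm : ∀ u v : V → ℝ, ∀ x y : V,
          (if X.Adj x y then (u x - u y) * (v x - v y) else 0) =
          (if X.Adj x y then u x - u y else 0) * (if X.Adj x y then v x - v y else 0) := by
        intro u v x y
        split_ifs
        · rfl
        · simp
      simp only [sq] at this
      simp only [hm, sq]
      exact this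
    have hgE0 : 0 ≤ ∑ x ∈ S, ∑ y ∈ S,
        (if X.Adj x y then (g x - g y) * (g x - g y) else 0) := by
      refine Finset.sum_nonneg fun x _ => Finset.sum_nonneg fun y _ => ?_
      split_ifs
      · exact mul_self_nonneg _
      · exact le_rfl
    have hfin' := hCS.trans (mul_le_mul hfE hgE hgE0 (by positivity))
    rw [e1] at hfin'
    nlinarith [hfin']
  have hD : (1 : ℝ) ≤ X.degree o := by exact_mod_cast hdeg o
  obtain ⟨t, ht⟩ := exists_nat_gt ((M : ℝ) * G * (l o + 1) + 1)
  have h := main (l o + t)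
  have hMG : 0 ≤ (M : ℝ) * G := by positivity
  have hsub : l o + t - l o = t := by omega
  rw [hsub] at h
  push_cast at h
  have hl0 : (0 : ℝ) ≤ l o := Nat.cast_nonneg _
  have ht1 : (1 : ℝ) ≤ t := by
    have : 0 ≤ (M : ℝ) * G * (l o + 1) := by positivity
    linarith
  have h1 : (X.degree o : ℝ) * (t : ℝ) ^ 2 ≤ (M : ℝ) * G * (l o + t) := by
    have hD0 : (0 : ℝ) < X.degree o := by linarith
    refine le_of_mul_le_mul_left ?_ hD0
    linarith [h]
  have h2 : (t : ℝ) ^ 2 ≤ (X.degree o : ℝ) * (t : ℝ) ^ 2 :=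
    le_mul_of_one_le_left (by positivity) hD
  have h3 : (M : ℝ) * G * (l o + t) ≤ (M : ℝ) * G * (l o + 1) * t := by
    have : (l o : ℝ) + t ≤ (l o + 1) * t := by nlinarith
    calc _ ≤ (M : ℝ) * G * ((l o + 1) * t) := mul_le_mul_of_nonneg_left this hMG
      _ = _ := by ring
  have h4 : (M : ℝ) * G * (l o + 1) * t < t * t :=
    mul_lt_mul_of_pos_right (by linarith) (by linarith)
  nlinarith
end

section
/- Let Y be a locally finite, connected, infinite graph on which the simple random walk is recurrent, and let x, y be vertices. Then the Green function G(x,y|z) = Σ_{n≥0} p^{(n)}(x,y) z^n, which is analytic on the open unit disc, has a non-polar singularity at z = 1; i.e., G(x,y|·) does not extend to a meromorphic function on any neighbourhood of 1 with a pole at 1. -/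
open SimpleGraph Set Metric

variable {V : Type*}

/-- The Green function of the simple random walk. -/
noncomputable def green (X : SimpleGraph V) [X.LocallyFinite] [DecidableEq V]
    (x y : V) (z : ℂ) : ℂ :=
  ∑' n : ℕ, (pstep X n x y : ℂ) * z ^ n


lemma pstep_nonneg (X : SimpleGraph V) [X.LocallyFinite] [DecidableEq V] (n : ℕ) (x y : V) :
    0 ≤ pstep X n x y := by
  induction n generalizing x with
  | zero => simp only [pstep]; split_ifs <;> norm_num
  | succ n ih => exact Finset.sum_nonneg fun z _ => div_nonneg (ih z) (Nat.cast_nonneg _)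

lemma pstep_sum_le (X : SimpleGraph V) [X.LocallyFinite] [DecidableEq V] (F : Finset V)
    (n : ℕ) (x : V) : ∑ y ∈ F, pstep X n x y ≤ 1 := by
  induction n generalizing x with
  | zero => simp only [pstep, Finset.sum_ite_eq]; split_ifs <;> norm_num
  | succ n ih =>
    simp only [pstep]
    rw [Finset.sum_comm]
    calc ∑ z ∈ X.neighborFinset x, ∑ y ∈ F, pstep X n z y / (X.degree x : ℝ)
        ≤ ∑ z ∈ X.neighborFinset x, 1 / (X.degree x : ℝ) := by
          refine Finset.sum_le_sum fun z _ => ?_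
          rw [← Finset.sum_div]
          exact div_le_div_of_nonneg_right (ih z) (Nat.cast_nonneg _)
      _ ≤ 1 := by
          rw [Finset.sum_const, X.card_neighborFinset_eq_degree, nsmul_eq_mul, mul_one_div]
          exact div_self_le_one _

lemma pstep_le_one (X : SimpleGraph V) [X.LocallyFinite] [DecidableEq V] (n : ℕ) (x y : V) :
    pstep X n x y ≤ 1 := by
  simpa using pstep_sum_le X {y} n x

lemma pstep_succ_right (X : SimpleGraph V) [X.LocallyFinite] [DecidableEq V]
    (n : ℕ) (x y : V) :
    pstep X (n + 1) x y = ∑ z ∈ X.neighborFinset y, pstep X n x z / (X.degree z : ℝ) := by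
  induction n generalizing x with
  | zero =>
    simp only [pstep, ite_div, zero_div]
    rw [Finset.sum_ite_eq', Finset.sum_ite_eq]
    have hiff : y ∈ X.neighborFinset x ↔ x ∈ X.neighborFinset y := by
      rw [X.mem_neighborFinset, X.mem_neighborFinset, X.adj_comm]
    by_cases hy : y ∈ X.neighborFinset x
    · rw [if_pos hy, if_pos (hiff.1 hy)]
    · rw [if_neg hy, if_neg (fun h => hy (hiff.2 h))]
  | succ n ih =>
    rw [pstep]
    simp only [ih]
    simp only [Finset.sum_div]
    rw [Finset.sum_comm]
    refine Finset.sum_congr rfl fun z _ => ?_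
    rw [pstep, Finset.sum_div]
    refine Finset.sum_congr rfl fun w _ => ?_
    rw [div_right_comm]

lemma pstep_reversible (X : SimpleGraph V) [X.LocallyFinite] [DecidableEq V]
    (hd : ∀ x, 0 < X.degree x) (n : ℕ) (x y : V) :
    (X.degree x : ℝ) * pstep X n x y = X.degree y * pstep X n y x := by
  have hd' : ∀ x, (X.degree x : ℝ) ≠ 0 := fun x => by exact_mod_cast (hd x).ne'
  induction n generalizing x with
  | zero =>
    simp only [pstep]
    by_cases h : x = y
    · subst h; rfl
    · simp [h, Ne.symm h]
  | succ n ih =>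
    rw [pstep_succ_right X n y x, pstep, Finset.mul_sum, Finset.mul_sum]
    refine Finset.sum_congr rfl fun z _ => ?_
    have := ih z
    have h1 := hd' x
    have h2 := hd' z
    field_simp
    linarith

/-- The Green function on the real line. -/
noncomputable def rgreen (X : SimpleGraph V) [X.LocallyFinite] [DecidableEq V]
    (x y : V) (r : ℝ) : ℝ := ∑' n : ℕ, pstep X n x y * r ^ n

lemma summable_rgreen (X : SimpleGraph V) [X.LocallyFinite] [DecidableEq V]
    (x y : V) {r : ℝ} (h0 : 0 ≤ r) (h1 : r < 1) : Summable fun n => pstep X n x y * r ^ n := by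
  refine Summable.of_nonneg_of_le (fun n => mul_nonneg (pstep_nonneg X n x y) (pow_nonneg h0 n))
    (fun n => ?_) (summable_geometric_of_lt_one h0 h1)
  exact mul_le_of_le_one_left (pow_nonneg h0 n) (pstep_le_one X n x y)

lemma green_ofReal (X : SimpleGraph V) [X.LocallyFinite] [DecidableEq V]
    (x y : V) (r : ℝ) : green X x y (r : ℂ) = (rgreen X x y r : ℂ) := by
  simp [green, rgreen, Complex.ofReal_tsum]

lemma rgreen_nonneg (X : SimpleGraph V) [X.LocallyFinite] [DecidableEq V]
    (x y : V) {r : ℝ} (h0 : 0 ≤ r) : 0 ≤ rgreen X x y r :=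
  tsum_nonneg fun n => mul_nonneg (pstep_nonneg X n x y) (pow_nonneg h0 n)

lemma rgreen_sum_le (X : SimpleGraph V) [X.LocallyFinite] [DecidableEq V]
    (x : V) (F : Finset V) {r : ℝ} (h0 : 0 ≤ r) (h1 : r < 1) :
    ∑ y ∈ F, (1 - r) * rgreen X x y r ≤ 1 := by
  rw [← Finset.mul_sum]
  have hs : ∑ y ∈ F, rgreen X x y r ≤ (1 - r)⁻¹ := by
    unfold rgreen
    rw [← Summable.tsum_finsetSum fun y _ => summable_rgreen X x y h0 h1,
      ← tsum_geometric_of_lt_one h0 h1]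
    refine Summable.tsum_le_tsum (fun n => ?_)
      (summable_sum fun y _ => summable_rgreen X x y h0 h1) (summable_geometric_of_lt_one h0 h1)
    rw [← Finset.sum_mul]
    exact mul_le_of_le_one_left (pow_nonneg h0 n) (pstep_sum_le X F n x)
  have h2 : 0 < 1 - r := by linarith
  calc (1 - r) * _ ≤ (1 - r) * (1 - r)⁻¹ := by gcongr
    _ = 1 := mul_inv_cancel₀ h2.ne'

lemma rgreen_reversible (X : SimpleGraph V) [X.LocallyFinite] [DecidableEq V]
    (hd : ∀ x, 0 < X.degree x) (x y : V) (r : ℝ) :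
    (X.degree x : ℝ) * rgreen X x y r = X.degree y * rgreen X y x r := by
  unfold rgreen
  rw [← tsum_mul_left, ← tsum_mul_left]
  refine tsum_congr fun n => ?_
  rw [← mul_assoc, pstep_reversible X hd, mul_assoc]

lemma rgreen_rec (X : SimpleGraph V) [X.LocallyFinite] [DecidableEq V]
    (x y : V) {r : ℝ} (h0 : 0 ≤ r) (h1 : r < 1) :
    rgreen X x y r = (if x = y then 1 else 0) +
      r * ∑ z ∈ X.neighborFinset x, rgreen X z y r / (X.degree x : ℝ) := by
  conv_lhs => rw [rgreen, (summable_rgreen X x y h0 h1).tsum_eq_zero_add]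
  congr 1
  · simp [pstep]
  · unfold rgreen
    rw [← Finset.sum_div,
      ← Summable.tsum_finsetSum fun z _ => summable_rgreen X z y h0 h1, ← tsum_div_const,
      ← tsum_mul_left]
    refine tsum_congr fun n => ?_
    rw [pstep, ← Finset.sum_div, ← Finset.sum_mul, pow_succ]
    ring

open Filter Topology in
lemma ev_real : ∀ᶠ r : ℝ in 𝓝[<] 1, 0 ≤ r ∧ r < 1 := by
  have : Ioo (0 : ℝ) 1 ∈ 𝓝[<] (1 : ℝ) := Ioo_mem_nhdsLT one_pos
  filter_upwards [this] with r hr using ⟨hr.1.le, hr.2⟩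

open Filter Topology in
lemma exists_limits (X : SimpleGraph V) [X.LocallyFinite] [DecidableEq V] (y : V)
    (f : Ultrafilter ℝ) (hf : (f : Filter ℝ) ≤ 𝓝[<] 1) (x : V) :
    ∃ a : ℝ, 0 ≤ a ∧ Tendsto (fun r => (1 - r) * rgreen X x y r) f (𝓝 a) := by
  have h : (f.map (fun r => (1 - r) * rgreen X x y r) : Filter ℝ) ≤ 𝓟 (Icc 0 1) := by
    rw [le_principal_iff]
    have hev : ∀ᶠ r : ℝ in f, 0 ≤ r ∧ r < 1 := hf ev_real
    change ∀ᶠ r : ℝ in f, (1 - r) * rgreen X x y r ∈ Icc (0 : ℝ) 1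
    filter_upwards [hev] with r hr
    refine ⟨mul_nonneg (by linarith [hr.2]) (rgreen_nonneg X x y hr.1), ?_⟩
    simpa using rgreen_sum_le X x {y} hr.1 hr.2
  obtain ⟨a, ha, hl⟩ := isCompact_Icc.ultrafilter_le_nhds _ h
  exact ⟨a, ha.1, hl⟩

open Filter Topology in
lemma limits_zero (X : SimpleGraph V) [X.LocallyFinite] [DecidableEq V]
    (hconn : X.Connected) (hinf : Infinite V) (y : V)
    (f : Ultrafilter ℝ) (hf : (f : Filter ℝ) ≤ 𝓝[<] 1) (x : V) :
    Tendsto (fun r => (1 - r) * rgreen X x y r) f (𝓝 0) := by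
  have hd : ∀ x, 0 < X.degree x := fun x => hconn.preconnected.degree_pos_of_nontrivial x
  choose a ha0 ha using exists_limits X y f hf
  have hev : ∀ᶠ r : ℝ in f, 0 ≤ r ∧ r < 1 := hf ev_real
  have hid : Tendsto (fun r : ℝ => r) f (𝓝 1) := hf.trans nhdsWithin_le_nhds
  -- summability
  have hsum : Summable a := by
    refine summable_of_sum_le (c := (X.degree y : ℝ)) ha0 fun F => ?_
    refine le_of_tendsto (tendsto_finsetSum F fun x _ => ha x) ?_
    filter_upwards [hev] with r hr
    calc ∑ x ∈ F, (1 - r) * rgreen X x y r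
        ≤ ∑ x ∈ F, (X.degree y : ℝ) * ((1 - r) * rgreen X y x r) := by
          refine Finset.sum_le_sum fun x _ => ?_
          have h1 := rgreen_reversible X hd x y r
          have h2 : (1 : ℝ) ≤ X.degree x := by exact_mod_cast hd x
          have h3 := rgreen_nonneg X x y hr.1
          have h4 : rgreen X x y r ≤ X.degree y * rgreen X y x r := by nlinarith
          have h5 : 0 ≤ 1 - r := by linarith [hr.2]
          nlinarith
      _ ≤ X.degree y := by
          rw [← Finset.mul_sum]
          exact mul_le_of_le_one_right (Nat.cast_nonneg _) (rgreen_sum_le X y F hr.1 hr.2)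
  -- harmonicity
  have hharm : ∀ x, a x = ∑ z ∈ X.neighborFinset x, a z / (X.degree x : ℝ) := by
    intro x
    have h1 : Tendsto (fun r : ℝ => (1 - r) * (if x = y then 1 else 0) +
        r * ∑ z ∈ X.neighborFinset x, ((1 - r) * rgreen X z y r) / (X.degree x : ℝ)) f
        (𝓝 ((1 - 1) * (if x = y then 1 else 0) +
          1 * ∑ z ∈ X.neighborFinset x, a z / (X.degree x : ℝ))) :=
      ((hid.const_sub 1).mul_const _).add
        (hid.mul (tendsto_finsetSum _ fun z _ => (ha z).div_const _))
    have h2 := tendsto_nhds_unique_of_eventuallyEq (ha x) h1 (by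
      filter_upwards [hev] with r hr
      rw [rgreen_rec X x y hr.1 hr.2, mul_add, ← Finset.sum_div, ← Finset.sum_div,
        ← Finset.mul_sum]
      ring)
    simpa using h2
  -- a is zero
  have hzero : ∀ x, a x = 0 := by
    by_contra! hne
    obtain ⟨x0, hx0⟩ := hne
    have hpos : 0 < a x0 := lt_of_le_of_ne (ha0 x0) (Ne.symm hx0)
    have hfin : {x | a x0 ≤ a x}.Finite := by
      have := hsum.tendsto_cofinite_zero.eventually_lt_const hpos
      rw [eventually_cofinite] at this
      simpa using this
    obtain ⟨m, hm, hmax⟩ := Set.exists_max_image _ a hfin ⟨x0, le_refl (a x0)⟩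
    have hmax' : ∀ z, a z ≤ a m := fun z => by
      by_cases h : a x0 ≤ a z
      · exact hmax z h
      · exact (not_le.1 h).le.trans hm
    have hstep : ∀ u v, X.Adj u v → a u = a m → a v = a m := by
      intro u v huv hu
      have h1 := hharm u
      have hdu : (0 : ℝ) < X.degree u := by exact_mod_cast hd u
      rw [← Finset.sum_div, eq_div_iff hdu.ne', hu] at h1
      have h2 : ∑ z ∈ X.neighborFinset u, a z = ∑ z ∈ X.neighborFinset u, a m := by
        rw [← h1, Finset.sum_const, X.card_neighborFinset_eq_degree, nsmul_eq_mul, mul_comm]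
      exact (Finset.sum_eq_sum_iff_of_le fun z _ => hmax' z).1 h2 v (by simpa using huv)
    have hall : ∀ v, a v = a m := by
      intro v
      obtain ⟨p⟩ := hconn.preconnected m v
      have : ∀ u v (p : X.Walk u v), a u = a m → a v = a m := by
        intro u v p
        induction p with
        | nil => exact id
        | cons h p ih => exact fun hu => ih (hstep _ _ h hu)
      exact this m v p rfl
    have : Summable fun _ : V => a m := by
      have h : a = fun _ => a m := funext hall
      rwa [h] at hsum
    rw [summable_const_iff] at this
    have := hall x0
    linarith
  have := ha x
  rwa [hzero x] at this

lemma not_summable_pstep (X : SimpleGraph V) [X.LocallyFinite] [DecidableEq V]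
    (hconn : X.Connected) (hrec : RWRecurrent X) (x y : V) :
    ¬ Summable (fun n => pstep X n x y) := by
  intro hs
  have key : ∀ u v, X.Adj u v → Summable (fun n => pstep X n u y) →
      Summable (fun n => pstep X n v y) := by
    intro u v huv hu
    have hd : (0 : ℝ) < X.degree u := by
      exact_mod_cast (X.degree_pos_iff_exists_adj u).2 ⟨v, huv⟩
    have h1 := ((summable_nat_add_iff 1).2 hu).mul_left (X.degree u : ℝ)
    refine Summable.of_nonneg_of_le (fun n => pstep_nonneg X n v y) (fun n => ?_) h1
    rw [pstep, ← Finset.sum_div, mul_div_cancel₀ _ hd.ne']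
    exact Finset.single_le_sum (f := fun z => pstep X n z y)
      (fun z _ => pstep_nonneg X n z y) (by simpa using huv)
  obtain ⟨p⟩ := hconn.preconnected x y
  have : ∀ u v (p : X.Walk u v), Summable (fun n => pstep X n u y) →
      Summable (fun n => pstep X n v y) := by
    intro u v p
    induction p with
    | nil => exact id
    | cons h p ih => exact fun hu => ih (key _ _ h hu)
  exact hrec y (this x y p hs)

open Filter Topology in
lemma rgreen_unbounded (X : SimpleGraph V) [X.LocallyFinite] [DecidableEq V]
    (hconn : X.Connected) (hrec : RWRecurrent X) (x y : V) (C : ℝ)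
    (hC : ∀ᶠ r : ℝ in 𝓝[<] 1, rgreen X x y r ≤ C) : False := by
  refine not_summable_pstep X hconn hrec x y
    (summable_of_sum_le (c := C) (fun n => pstep_nonneg X n x y) fun F => ?_)
  have h1 : Tendsto (fun r : ℝ => ∑ n ∈ F, pstep X n x y * r ^ n) (𝓝[<] 1)
      (𝓝 (∑ n ∈ F, pstep X n x y * 1 ^ n)) :=
    tendsto_finsetSum _ fun n _ =>
      ((tendsto_nhdsWithin_of_tendsto_nhds tendsto_id).pow n).const_mul _
  simp only [one_pow, mul_one] at h1
  refine le_of_tendsto h1 ?_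
  filter_upwards [hC, ev_real] with r hr h01
  exact ((summable_rgreen X x y h01.1 h01.2).sum_le_tsum F fun n _ =>
    mul_nonneg (pstep_nonneg X n x y) (pow_nonneg h01.1 n)).trans hr

open Filter Topology in
/-- Lemma 7.1: for a recurrent simple random walk on a locally finite, connected, infinite
graph, z = 1 is a non-polar singularity of every Green function: G(x,y|·) admits no
meromorphic extension `g(z)/(1-z)^k` (with `g` analytic near 1) to any neighbourhood of 1. -/
theorem green_nonpolar_at_one (X : SimpleGraph V) [X.LocallyFinite] [DecidableEq V]
    (hconn : X.Connected) (hinf : Infinite V) (hrec : RWRecurrent X) (x y : V) :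
    ¬ ∃ (k : ℕ) (g : ℂ → ℂ) (ε : ℝ), 0 < ε ∧
      AnalyticOnNhd ℂ g (ball (1 : ℂ) ε) ∧
      ∀ z ∈ ball (1 : ℂ) ε, ‖z‖ < 1 → green X x y z = g z / (1 - z) ^ k := by
  rintro ⟨k, g, ε, hε, hg, hG⟩
  have hga : AnalyticAt ℂ g 1 := hg 1 (mem_ball_self hε)
  have hcoe : Tendsto (fun r : ℝ => (r : ℂ)) (𝓝[<] 1) (𝓝 1) := by
    have := (Complex.continuous_ofReal.tendsto 1).mono_left (nhdsWithin_le_nhds (s := Iio 1))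
    simpa using this
  have hev : ∀ᶠ r : ℝ in 𝓝[<] 1, rgreen X x y r * (1 - r) ^ k = ‖g r‖ := by
    filter_upwards [hcoe (ball_mem_nhds 1 hε), ev_real] with r hr h01
    have h := hG r hr (by simpa [abs_of_nonneg h01.1] using h01.2)
    have h1 : (0 : ℝ) < 1 - r := by linarith [h01.2]
    have h2 : (1 - (r : ℂ)) ≠ 0 := by exact_mod_cast h1.ne'
    rw [green_ofReal, eq_div_iff (pow_ne_zero k h2)] at h
    rw [← h]
    have h3 : (rgreen X x y r : ℂ) * (1 - (r : ℂ)) ^ k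
      = ((rgreen X x y r * (1 - r) ^ k : ℝ) : ℂ) := by push_cast; rfl
    rw [h3, Complex.norm_real, Real.norm_of_nonneg]
    exact mul_nonneg (rgreen_nonneg X x y h01.1) (pow_nonneg h1.le k)
  by_cases hz : ∀ᶠ z in 𝓝 (1 : ℂ), g z = 0
  · refine rgreen_unbounded X hconn hrec x y 0 ?_
    filter_upwards [hcoe.eventually hz, hev, ev_real] with r hr h h01
    have h1 : (0 : ℝ) < 1 - r := by linarith [h01.2]
    rw [hr, norm_zero] at h
    exact ((mul_eq_zero.1 h).resolve_right (pow_ne_zero k h1.ne')).le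
  · obtain ⟨m, h, hh, hne, heq⟩ := hga.exists_eventuallyEq_pow_smul_nonzero_iff.2 hz
    have hlim : Tendsto (fun r : ℝ => ‖h r‖) (𝓝[<] 1) (𝓝 ‖h 1‖) :=
      (hh.continuousAt.tendsto.comp hcoe).norm
    have hev2 : ∀ᶠ r : ℝ in 𝓝[<] 1,
        rgreen X x y r * (1 - r) ^ k = (1 - r) ^ m * ‖h r‖ := by
      filter_upwards [hcoe.eventually heq, hev, ev_real] with r hr h' h01
      have h1 : (0 : ℝ) < 1 - r := by linarith [h01.2]
      rw [h', hr, norm_smul, norm_pow]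
      congr 2
      rw [norm_sub_rev]
      have : (1 - (r : ℂ)) = ((1 - r : ℝ) : ℂ) := by push_cast; rfl
      rw [this, Complex.norm_real, Real.norm_of_nonneg h1.le]
    rcases le_or_gt k m with hkm | hkm
    · refine rgreen_unbounded X hconn hrec x y (‖h 1‖ + 1) ?_
      filter_upwards [hlim.eventually_lt_const (lt_add_one _), hev2, ev_real] with r hr h' h01
      have h1 : (0 : ℝ) < 1 - r := by linarith [h01.2]
      obtain ⟨d, rfl⟩ := Nat.exists_eq_add_of_le hkm
      have h3 : rgreen X x y r = (1 - r) ^ d * ‖h r‖ := by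
        apply mul_right_cancel₀ (pow_ne_zero k h1.ne')
        rw [h', pow_add]; ring
      rw [h3]
      have h4 : (1 - r) ^ d ≤ 1 := pow_le_one₀ h1.le (by linarith [h01.1])
      exact (mul_le_of_le_one_left (norm_nonneg _) h4).trans hr.le
    · obtain ⟨d, rfl⟩ := Nat.exists_eq_add_of_lt hkm
      let f : Ultrafilter ℝ := Ultrafilter.of (𝓝[<] (1 : ℝ))
      have hf : (f : Filter ℝ) ≤ 𝓝[<] 1 := Ultrafilter.of_le _
      have h0 := limits_zero X hconn hinf y f hf x
      have hid : Tendsto (fun r : ℝ => r) f (𝓝 1) := hf.trans nhdsWithin_le_nhds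
      have h5 : Tendsto (fun r : ℝ => (1 - r) ^ d * ((1 - r) * rgreen X x y r)) f
          (𝓝 ((1 - 1) ^ d * 0)) := ((hid.const_sub 1).pow d).mul h0
      have h6 := tendsto_nhds_unique_of_eventuallyEq h5 (hlim.mono_left hf) (by
        filter_upwards [hf hev2, hf ev_real] with r h' h01
        have h1 : (0 : ℝ) < 1 - r := by linarith [h01.2]
        apply mul_left_cancel₀ (pow_ne_zero m h1.ne')
        rw [← h']; ring)
      rw [mul_zero] at h6
      exact hne (norm_eq_zero.1 h6.symm)
end

section
/- Let d be the transition function of a symmetrically self-similar graph X. Then z = 0 is a superattracting fixed point of d (d(0) = 0 and d'(0) = 0), the order of vanishing of d at 0 equals the diameter of the boundary θC of a cell (which is at least 2), and z = 1 is a repelling fixed point: d(1) = 1 and d'(1) > 2. -/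
open SimpleGraph Set

variable {V : Type*} [Fintype V] [DecidableEq V]

/-- `hitProb G B n x` : probability that the simple random walk on `G` started at `x`
first hits the absorbing set `B` after exactly `n` steps. -/
noncomputable def hitProb (G : SimpleGraph V) [DecidableRel G.Adj] (B : Finset V) :
    ℕ → V → ℝ
  | 0, x => if x ∈ B then 1 else 0
  | (n + 1), x =>
      if x ∈ B then 0
      else ∑ y ∈ G.neighborFinset x, hitProb G B n y / (G.degree x : ℝ)

lemma hitProb_nonneg (G : SimpleGraph V) [DecidableRel G.Adj] (A : Finset V) (n : ℕ) :
    ∀ x, 0 ≤ hitProb G A n x := by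
  induction n with
  | zero => intro x; simp only [hitProb]; split_ifs <;> norm_num
  | succ n ih =>
    intro x; simp only [hitProb]; split_ifs
    · norm_num
    · exact Finset.sum_nonneg fun y _ => div_nonneg (ih y) (Nat.cast_nonneg _)

lemma hitProb_walk (G : SimpleGraph V) [DecidableRel G.Adj] (A : Finset V) (n : ℕ) :
    ∀ x, hitProb G A n x ≠ 0 → ∃ a ∈ A, ∃ p : G.Walk x a, p.length = n := by
  induction n with
  | zero =>
    intro x h
    simp only [hitProb, ne_eq, ite_eq_right_iff, one_ne_zero, imp_false, not_not] at h
    exact ⟨x, h, Walk.nil, rfl⟩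
  | succ n ih =>
    intro x h
    simp only [hitProb] at h
    split_ifs at h
    · exact absurd rfl h
    · obtain ⟨y, hy, hne⟩ := Finset.exists_ne_zero_of_sum_ne_zero h
      have : hitProb G A n y ≠ 0 := fun h0 => hne (by rw [h0, zero_div])
      obtain ⟨a, ha, p, hp⟩ := ih y this
      exact ⟨a, ha, Walk.cons ((G.mem_neighborFinset x y).1 hy) p, by simp [hp]⟩

lemma hitProb_pos (G : SimpleGraph V) [DecidableRel G.Adj] (A : Finset V) (n : ℕ) :
    ∀ x, (∃ a ∈ A, ∃ p : G.Walk x a, p.length = n) →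
      (∀ a ∈ A, ∀ p : G.Walk x a, n ≤ p.length) → 0 < hitProb G A n x := by
  induction n with
  | zero =>
    rintro x ⟨a, ha, p, hp⟩ _
    have := Walk.eq_of_length_eq_zero hp
    subst this
    simp [hitProb, ha]
  | succ n ih =>
    rintro x ⟨a, ha, p, hp⟩ hmin
    have hx : x ∉ A := fun h => by simpa using hmin x h Walk.nil
    cases p with
    | nil => simp at hp
    | @cons _ y _ hxy q =>
      have hq : q.length = n := by simpa using hp
      have hpos : 0 < hitProb G A n y := by
        refine ih y ⟨a, ha, q, hq⟩ ?_
        intro b hb r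
        have := hmin b hb (Walk.cons hxy r)
        simpa using this
      have hdeg : 0 < G.degree x := (G.degree_pos_iff_exists_adj x).2 ⟨y, hxy⟩
      simp only [hitProb, hx, if_false]
      refine Finset.sum_pos' (fun z _ => div_nonneg (hitProb_nonneg G A n z) (Nat.cast_nonneg _))
        ⟨y, (G.mem_neighborFinset x y).2 hxy, div_pos hpos (by exact_mod_cast hdeg)⟩

/-- Survival probability. -/
noncomputable def surv (G : SimpleGraph V) [DecidableRel G.Adj] (A : Finset V)
    (n : ℕ) (x : V) : ℝ := 1 - ∑ k ∈ Finset.range (n + 1), hitProb G A k x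

lemma surv_zero (G : SimpleGraph V) [DecidableRel G.Adj] (A : Finset V) (x : V) :
    surv G A 0 x = if x ∈ A then 0 else 1 := by
  simp only [surv, zero_add, Finset.sum_range_one, hitProb]; split_ifs <;> norm_num

lemma surv_mem (G : SimpleGraph V) [DecidableRel G.Adj] (A : Finset V) (n : ℕ) (x : V)
    (hx : x ∈ A) : surv G A n x = 0 := by
  simp only [surv]
  rw [Finset.sum_range_succ']
  simp [hitProb, hx]

lemma surv_succ (G : SimpleGraph V) [DecidableRel G.Adj] (A : Finset V) (n : ℕ) (x : V)
    (hx : x ∉ A) (hd : 0 < G.degree x) :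
    surv G A (n + 1) x = ∑ y ∈ G.neighborFinset x, surv G A n y / (G.degree x : ℝ) := by
  have hd' : (G.degree x : ℝ) ≠ 0 := by exact_mod_cast hd.ne'
  simp only [surv]
  rw [Finset.sum_range_succ']
  simp only [hitProb, hx, if_false, add_zero, sub_div, Finset.sum_sub_distrib, Finset.sum_const,
    card_neighborFinset_eq_degree, nsmul_eq_mul]
  rw [Finset.sum_comm, mul_one_div_cancel hd']
  simp only [Finset.sum_div]

lemma surv_nonneg (G : SimpleGraph V) [DecidableRel G.Adj] (A : Finset V)
    (hd : ∀ x, 0 < G.degree x) (n : ℕ) : ∀ x, 0 ≤ surv G A n x := by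
  induction n with
  | zero => intro x; rw [surv_zero]; split_ifs <;> norm_num
  | succ n ih =>
    intro x
    by_cases hx : x ∈ A
    · rw [surv_mem G A _ x hx]
    · rw [surv_succ G A n x hx (hd x)]
      exact Finset.sum_nonneg fun y _ => div_nonneg (ih y) (Nat.cast_nonneg _)

lemma surv_step (G : SimpleGraph V) [DecidableRel G.Adj] (A : Finset V) (n : ℕ) (x : V) :
    surv G A (n + 1) x = surv G A n x - hitProb G A (n + 1) x := by
  simp only [surv]; rw [Finset.sum_range_succ _ (n + 1)]; ring

lemma surv_anti (G : SimpleGraph V) [DecidableRel G.Adj] (A : Finset V) (x : V) :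
    Antitone (fun n => surv G A n x) :=
  antitone_nat_of_succ_le fun n => by
    rw [surv_step]; linarith [hitProb_nonneg G A (n + 1) x]

lemma surv_le_one (G : SimpleGraph V) [DecidableRel G.Adj] (A : Finset V) (n : ℕ) (x : V) :
    surv G A n x ≤ 1 := by
  have := Finset.sum_nonneg (s := Finset.range (n + 1)) fun k _ => hitProb_nonneg G A k x
  simp only [surv]; linarith

lemma surv_mul (G : SimpleGraph V) [DecidableRel G.Adj] (A : Finset V)
    (hd : ∀ x, 0 < G.degree x) (N : ℕ) (c : ℝ) (hc : ∀ x, surv G A N x ≤ c) (m : ℕ) :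
    ∀ x, surv G A (m + N) x ≤ c * surv G A m x := by
  induction m with
  | zero =>
    intro x
    by_cases hx : x ∈ A
    · rw [surv_mem G A _ x hx, surv_mem G A _ x hx, mul_zero]
    · rw [surv_zero, if_neg hx, mul_one, zero_add]; exact hc x
  | succ m ih =>
    intro x
    by_cases hx : x ∈ A
    · rw [surv_mem G A _ x hx, surv_mem G A _ x hx, mul_zero]
    · rw [Nat.add_right_comm, surv_succ G A _ x hx (hd x), surv_succ G A _ x hx (hd x),
        Finset.mul_sum]
      refine Finset.sum_le_sum fun y _ => ?_
      rw [← mul_div_assoc]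
      exact div_le_div_of_nonneg_right (ih y) (Nat.cast_nonneg _)

lemma surv_lt_one (G : SimpleGraph V) [DecidableRel G.Adj] (hconn : G.Connected) (A : Finset V)
    (hA : A.Nonempty) (x : V) : ∃ n, surv G A n x < 1 := by
  classical
  obtain ⟨a, ha, hmin⟩ := Finset.exists_min_image A (fun a => G.dist x a) hA
  obtain ⟨p, hp⟩ := hconn.exists_walk_length_eq_dist x a
  have hpos := hitProb_pos G A (G.dist x a) x ⟨a, ha, p, hp⟩
    fun b hb r => (hmin b hb).trans (dist_le r)
  refine ⟨G.dist x a, ?_⟩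
  have := Finset.single_le_sum (s := Finset.range (G.dist x a + 1))
    (f := fun k => hitProb G A k x) (fun k _ => hitProb_nonneg G A k x)
    (Finset.self_mem_range_succ (G.dist x a))
  simp only [surv]; linarith

lemma surv_geom (G : SimpleGraph V) [DecidableRel G.Adj] (hconn : G.Connected) (A : Finset V)
    (hA : A.Nonempty) (hd : ∀ x, 0 < G.degree x) :
    ∃ r K : ℝ, 0 < r ∧ r < 1 ∧ 0 < K ∧ ∀ n x, surv G A n x ≤ K * r ^ n := by
  classical
  choose f hf using surv_lt_one G hconn A hA
  set N := Finset.univ.sup f + 1 with hN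
  have hlt : ∀ x, surv G A N x < 1 := fun x =>
    lt_of_le_of_lt (surv_anti G A x
      ((Finset.le_sup (f := f) (Finset.mem_univ x)).trans (Nat.le_succ _))) (hf x)
  obtain ⟨x0, -, hx0⟩ := Finset.exists_max_image Finset.univ (surv G A N)
    ⟨hA.choose, Finset.mem_univ _⟩
  set c := surv G A N x0
  have hc1 : c < 1 := hlt x0
  have hcont : Filter.Tendsto (fun r : ℝ => r ^ N) (nhdsWithin 1 (Set.Iio 1)) (nhds 1) := by
    have : Continuous fun r : ℝ => r ^ N := continuous_pow N
    simpa using (this.tendsto 1).mono_left nhdsWithin_le_nhds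
  have h1 := hcont.eventually (lt_mem_nhds hc1)
  have h2 : ∀ᶠ r : ℝ in nhdsWithin 1 (Set.Iio 1), 0 < r :=
    nhdsWithin_le_nhds (lt_mem_nhds one_pos)
  obtain ⟨r, ⟨hr1, hr2⟩, hr3⟩ := ((h1.and h2).and self_mem_nhdsWithin).exists
  have hr3 : r < 1 := hr3
  refine ⟨r, (r ^ N)⁻¹, hr2, hr3, by positivity, ?_⟩
  have hmul := surv_mul G A hd N (r ^ N) (fun x => (hx0 x (Finset.mem_univ x)).trans hr1.le)
  intro n
  induction n using Nat.strong_induction_on with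
  | _ n ih =>
    intro x
    by_cases hn : n < N
    · refine (surv_le_one G A n x).trans ?_
      rw [← div_eq_inv_mul, one_le_div (by positivity)]
      exact pow_le_pow_of_le_one hr2.le hr3.le hn.le
    · obtain ⟨m, rfl⟩ := Nat.exists_eq_add_of_le' (not_lt.1 hn)
      have := ih m (by omega) x
      refine (hmul m x).trans ((mul_le_mul_of_nonneg_left this (by positivity)).trans ?_)
      rw [pow_add]; apply le_of_eq; ring

lemma series_deriv (a : ℕ → ℝ) (r K : ℝ) (hr : 0 < r) (hr1 : r < 1) (hK : 0 < K)
    (ha0 : ∀ n, 0 ≤ a n) (ha : ∀ n, a n ≤ K * r ^ n) (z : ℝ) (hz : |z| ≤ 1) :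
    Summable (fun n : ℕ => a n * (n * z ^ (n - 1))) ∧
    HasDerivAt (fun z : ℝ => ∑' n : ℕ, a n * z ^ n) (∑' n : ℕ, a n * (n * z ^ (n - 1))) z := by
  obtain ⟨R, hR1, hR2⟩ := exists_between ((one_lt_inv₀ hr).2 hr1)
  have hR0 : 0 < R := by linarith
  have hrR : r * R < 1 := by
    have := mul_lt_mul_of_pos_left hR2 hr
    rwa [mul_inv_cancel₀ hr.ne'] at this
  have hsum : Summable (fun n : ℕ => K * (n * (r * R) ^ n)) := by
    have := summable_pow_mul_geometric_of_norm_lt_one (R := ℝ) 1 (r := r * R)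
      (by rw [Real.norm_eq_abs, abs_of_pos (by positivity)]; exact hrR)
    simpa using this.mul_left K
  have hb : ∀ (n : ℕ) (y : ℝ), y ∈ Metric.ball (0 : ℝ) R →
      ‖a n * (n * y ^ (n - 1))‖ ≤ K * (n * (r * R) ^ n) := by
    intro n y hy
    have hy : |y| < R := by simpa using hy
    rw [norm_mul, norm_mul, norm_pow, Real.norm_eq_abs, Real.norm_eq_abs, Real.norm_eq_abs,
      abs_of_nonneg (ha0 n), Nat.abs_cast]
    have h1 : |y| ^ (n - 1) ≤ R ^ n :=
      (pow_le_pow_left₀ (abs_nonneg y) hy.le _).trans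
        (pow_le_pow_right₀ hR1.le (Nat.sub_le n 1))
    calc a n * (n * |y| ^ (n - 1)) ≤ (K * r ^ n) * (n * R ^ n) :=
          mul_le_mul (ha n) (mul_le_mul_of_nonneg_left h1 (Nat.cast_nonneg _))
            (by positivity) (by positivity)
      _ = _ := by rw [mul_pow]; ring
  have hzm : z ∈ Metric.ball (0 : ℝ) R := by simpa using lt_of_le_of_lt hz hR1
  refine ⟨Summable.of_norm_bounded hsum fun n => hb n z hzm, ?_⟩
  refine hasDerivAt_tsum_of_isPreconnected (t := Metric.ball (0 : ℝ) R) (y₀ := 0)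
    (g := fun n z => a n * z ^ n) (g' := fun n z => a n * (n * z ^ (n - 1))) hsum
    Metric.isOpen_ball
    (convex_ball (0 : ℝ) R).isPreconnected (fun n y _ => (hasDerivAt_pow n y).const_mul _)
    hb (by simpa using hR0) ?_ hzm
  refine summable_of_ne_finset_zero (s := {0}) fun n hn => ?_
  have : n ≠ 0 := by simpa using hn
  simp [this]

/-- Lemma 6.1: let Ĉ be the (finite, connected) graph spanned by the closure of a cell,
with boundary B whose vertices are pairwise non-adjacent (axiom F1) and pairwise at the
same distance D (by double transitivity, D = diam θC). The transition function
d(z) = Σₙ aₙ zⁿ, where aₙ is the probability that the walk started at v ∈ B first hits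
B \ {v} at time n, has a superattracting fixed point at 0 of order D ≥ 2 (d(0) = 0,
d'(0) = 0, the order of vanishing is D) and a repelling fixed point at 1:
d(1) = 1 and d'(1) > 2. -/
theorem transition_function_fixed_points
    (G : SimpleGraph V) [DecidableRel G.Adj] (hconn : G.Connected)
    (B : Finset V) (hB2 : 2 ≤ B.card)
    (hBnadj : ∀ x ∈ B, ∀ y ∈ B, x ≠ y → ¬ G.Adj x y)
    (D : ℕ) (hD : ∀ x ∈ B, ∀ y ∈ B, x ≠ y → G.dist x y = D)
    (v : V) (hv : v ∈ B) :
    (fun z : ℝ => ∑' n : ℕ, hitProb G (B.erase v) n v * z ^ n) 0 = 0 ∧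
    deriv (fun z : ℝ => ∑' n : ℕ, hitProb G (B.erase v) n v * z ^ n) 0 = 0 ∧
    (∀ n < D, hitProb G (B.erase v) n v = 0) ∧
    hitProb G (B.erase v) D v ≠ 0 ∧
    2 ≤ D ∧
    (fun z : ℝ => ∑' n : ℕ, hitProb G (B.erase v) n v * z ^ n) 1 = 1 ∧
    2 < deriv (fun z : ℝ => ∑' n : ℕ, hitProb G (B.erase v) n v * z ^ n) 1 := by
  have hcard : 0 < (B.erase v).card := by rw [Finset.card_erase_of_mem hv]; omega
  obtain ⟨w, hw⟩ := Finset.card_pos.1 hcard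
  obtain ⟨hwv, hwB⟩ := Finset.mem_erase.1 hw
  have hdvw : G.dist v w = D := hD v hv w hwB hwv.symm
  have hnt : Nontrivial V := ⟨v, w, hwv.symm⟩
  have hd : ∀ x, 0 < G.degree x := fun x => hconn.preconnected.degree_pos_of_nontrivial x
  have hvA : v ∉ B.erase v := Finset.notMem_erase v B
  have hD2 : 2 ≤ D := by
    have h0 : D ≠ 0 := by
      rw [← hdvw]; exact (hconn.pos_dist_of_ne hwv.symm).ne'
    have h1 : D ≠ 1 := by
      intro h
      rw [h] at hdvw
      exact hBnadj v hv w hwB hwv.symm (SimpleGraph.dist_eq_one_iff_adj.1 hdvw)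
    omega
  have hzero : ∀ n < D, hitProb G (B.erase v) n v = 0 := by
    intro n hn
    by_contra hne
    obtain ⟨a, ha, p, hp⟩ := hitProb_walk G _ n v hne
    obtain ⟨hav, haB⟩ := Finset.mem_erase.1 ha
    have := hD v hv a haB hav.symm
    have := SimpleGraph.dist_le p
    omega
  have hDpos : 0 < hitProb G (B.erase v) D v := by
    obtain ⟨p, hp⟩ := hconn.exists_walk_length_eq_dist v w
    refine hitProb_pos G _ D v ⟨w, hw, p, hp.trans hdvw⟩ fun a ha q => ?_
    obtain ⟨hav, haB⟩ := Finset.mem_erase.1 ha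
    rw [← hD v hv a haB hav.symm]
    exact SimpleGraph.dist_le q
  have hs2 : 0 < surv G (B.erase v) 2 v := by
    obtain ⟨y, hy⟩ := (G.degree_pos_iff_exists_adj v).1 (hd v)
    have hyA : y ∉ B.erase v := fun h =>
      hBnadj v hv y (Finset.mem_of_mem_erase h) hy.ne hy
    have h1 : 0 < surv G (B.erase v) 1 y := by
      rw [surv_succ G _ 0 y hyA (hd y)]
      refine Finset.sum_pos' (fun z _ => div_nonneg (surv_nonneg G _ hd 0 z) (Nat.cast_nonneg _))
        ⟨v, (G.mem_neighborFinset y v).2 hy.symm, div_pos ?_ (by exact_mod_cast hd y)⟩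
      rw [surv_zero, if_neg hvA]; norm_num
    rw [surv_succ G _ 1 v hvA (hd v)]
    exact Finset.sum_pos' (fun z _ => div_nonneg (surv_nonneg G _ hd 1 z) (Nat.cast_nonneg _))
        ⟨y, (G.mem_neighborFinset v y).2 hy, div_pos h1 (by exact_mod_cast hd v)⟩
  obtain ⟨r, K, hr, hr1, hK, hgeo⟩ := surv_geom G hconn _ ⟨w, hw⟩ hd
  have hsv : ∀ n, surv G (B.erase v) n v =
      1 - ∑ k ∈ Finset.range (n + 1), hitProb G (B.erase v) k v := fun n => rfl
  have hstep := fun n => surv_step G (B.erase v) n v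
  have hs0 := fun n => surv_nonneg G (B.erase v) hd n v
  have hp0 := fun n => hitProb_nonneg G (B.erase v) n v
  have hgv := fun n => hgeo n v
  generalize ha : (fun n => hitProb G (B.erase v) n v) = a at *
  have ha' : ∀ n, hitProb G (B.erase v) n v = a n := fun n => congrFun ha n
  simp only [ha'] at *
  have hbound : ∀ n, a n ≤ (K / r) * r ^ n := by
    intro n
    cases n with
    | zero => rw [hzero 0 (by omega)]; positivity
    | succ n =>
      have h1 := hstep n
      have h2 := hs0 (n + 1)
      have h3 := hgv n
      have : K / r * r ^ (n + 1) = K * r ^ n := by rw [pow_succ]; field_simp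
      rw [this]; linarith
  have hser := series_deriv a r (K / r) hr hr1 (by positivity) hp0 hbound
  have ha0 : a 0 = 0 := hzero 0 (by omega)
  have ha1 : a 1 = 0 := hzero 1 (by omega)
  have hHS : HasSum a 1 := by
    rw [hasSum_iff_tendsto_nat_of_nonneg hp0, ← Filter.tendsto_add_atTop_iff_nat 1]
    have hs : Filter.Tendsto (fun n => surv G (B.erase v) n v) Filter.atTop (nhds 0) := by
      refine squeeze_zero hs0 hgv ?_
      simpa using (tendsto_pow_atTop_nhds_zero_of_lt_one hr.le hr1).const_mul K
    have := hs.const_sub 1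
    simp only [hsv, sub_sub_cancel, sub_zero] at this
    exact this
  refine ⟨?_, ?_, hzero, hDpos.ne', hD2, ?_, ?_⟩
  · convert tsum_zero using 2
    ext n
    cases n with
    | zero => simp [ha0]
    | succ n => simp
  · rw [(hser 0 (by simp)).2.deriv]
    convert tsum_zero using 2
    ext n
    rcases n with _ | _ | n <;> simp [ha1]
  · simpa using hHS.tsum_eq
  · obtain ⟨hsm, hder⟩ := hser 1 (by simp)
    rw [hder.deriv]
    simp only [one_pow, mul_one] at hsm ⊢
    have h3 : ∃ n, 3 ≤ n ∧ 0 < a n := by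
      by_contra! hcon
      have hle : ∀ n, n ∉ Finset.range 3 → a n = 0 := fun n hn =>
        le_antisymm (hcon n (by simpa using hn)) (hp0 n)
      have := (hasSum_sum_of_ne_finset_zero hle).unique hHS
      have := hsv 2
      norm_num at this
      linarith
    obtain ⟨n, hn, hpos⟩ := h3
    have h2 : HasSum (fun n => a n * 2) 2 := by simpa using hHS.mul_right 2
    rw [← h2.tsum_eq]
    refine Summable.tsum_lt_tsum (i := n) ?_ ?_ h2.summable hsm
    · intro m
      rcases m with _ | _ | m
      · simp [ha0]
      · simp [ha1]
      · refine mul_le_mul_of_nonneg_left ?_ (hp0 _)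
        push_cast; linarith [Nat.cast_nonneg (α := ℝ) m]
    · refine mul_lt_mul_of_pos_left ?_ hpos
      exact_mod_cast hn
end
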